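/- (Theorem 2) Let ρ be a bipartite density matrix on nA × nB. Then the one-sided discord and the local coherences together bound the total coherence from below: Θ^{A|B}(ρ) + C(ρ^A) + C(ρ^B) ≤ C(ρ). -/

import Mathlib

open Matrix
open Kronecker
open scoped ComplexOrder

/-- Von Neumann entropy of a matrix (defined via its eigenvalues when it is Hermitian). -/
noncomputable def vN {n : Type*} [Fintype n] [DecidableEq n] (ρ : Matrix n n ℂ) : ℝ :=
  letI := Classical.propDecidable ρ.IsHermitian
  if h : ρ.IsHermitian then ∑ i, Real.negMulLog (h.eigenvalues i) else 0

/-- Full dephasing in the standard basis. -/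
noncomputable def deph {n : Type*} [Fintype n] [DecidableEq n] (ρ : Matrix n n ℂ) :
    Matrix n n ℂ := Matrix.diagonal fun i => ρ i i

/-- Relative entropy of coherence in the standard basis. -/
noncomputable def coh {n : Type*} [Fintype n] [DecidableEq n] (ρ : Matrix n n ℂ) : ℝ :=
  vN (deph ρ) - vN ρ

/-- Partial dephasing on the first (A) subsystem of a bipartite state. -/
noncomputable def dephA {nA nB : Type*} [Fintype nA] [DecidableEq nA]
    [Fintype nB] [DecidableEq nB] (ρ : Matrix (nA × nB) (nA × nB) ℂ) :
    Matrix (nA × nB) (nA × nB) ℂ :=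
  Matrix.of fun p q => if p.1 = q.1 then ρ p q else 0

/-- Reduced state on subsystem A. -/
noncomputable def redA {nA nB : Type*} [Fintype nA] [DecidableEq nA]
    [Fintype nB] [DecidableEq nB] (ρ : Matrix (nA × nB) (nA × nB) ℂ) : Matrix nA nA ℂ :=
  Matrix.of fun a a' => ∑ b, ρ (a, b) (a', b)

/-- Reduced state on subsystem B. -/
noncomputable def redB {nA nB : Type*} [Fintype nA] [DecidableEq nA]
    [Fintype nB] [DecidableEq nB] (ρ : Matrix (nA × nB) (nA × nB) ℂ) : Matrix nB nB ℂ :=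
  Matrix.of fun b b' => ∑ a, ρ (a, b) (a, b')

/-- Quantum mutual information of a bipartite state. -/
noncomputable def mi {nA nB : Type*} [Fintype nA] [DecidableEq nA]
    [Fintype nB] [DecidableEq nB] (ρ : Matrix (nA × nB) (nA × nB) ℂ) : ℝ :=
  vN (redA ρ) + vN (redB ρ) - vN ρ

/-- The action `(U ⊗ 1) ρ (U ⊗ 1)∗` of a local unitary on the A subsystem. -/
noncomputable def conjA {nA nB : Type*} [Fintype nA] [DecidableEq nA]
    [Fintype nB] [DecidableEq nB] (U : Matrix nA nA ℂ)
    (ρ : Matrix (nA × nB) (nA × nB) ℂ) : Matrix (nA × nB) (nA × nB) ℂ :=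
  (U ⊗ₖ (1 : Matrix nB nB ℂ)) * ρ * (U ⊗ₖ (1 : Matrix nB nB ℂ))ᴴ

lemma Matrix.IsHermitian.vN_eq_sum_negMulLog {n : Type*} [Fintype n] [DecidableEq n]
    {M : Matrix n n ℂ} (h : M.IsHermitian) :
    vN M = ∑ i, Real.negMulLog (h.eigenvalues i) := by
  simp [vN, h]

lemma vN_diagonal {n : Type*} [Fintype n] [DecidableEq n] (d : n → ℝ) :
    vN (Matrix.diagonal fun i => (d i : ℂ)) = ∑ i, Real.negMulLog (d i) := by
  have h : (Matrix.diagonal fun i => (d i : ℂ)).IsHermitian := by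
    refine Matrix.isHermitian_diagonal_of_self_adjoint _ ?_
    ext i
    simp
  have hroots := h.roots_charpoly_eq_eigenvalues
  rw [Matrix.charpoly_diagonal, Polynomial.roots_prod _ _
    (by simp [Finset.prod_ne_zero_iff, Polynomial.X_sub_C_ne_zero])] at hroots
  have := congrArg (fun s => (s.map fun z : ℂ => Real.negMulLog z.re).sum) hroots
  simp only [Polynomial.roots_X_sub_C, Multiset.bind_singleton, Multiset.map_map,
    Function.comp_def, Complex.ofReal_re, Complex.coe_algebraMap] at this
  rw [h.vN_eq_sum_negMulLog]
  exact this.symm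

lemma trace_dephA {nA nB : Type*} [Fintype nA] [DecidableEq nA] [Fintype nB] [DecidableEq nB]
    (M : Matrix (nA × nB) (nA × nB) ℂ) : (dephA M).trace = M.trace := by
  simp [dephA, Matrix.trace]

lemma Matrix.PosSemidef.redA {nA nB : Type*} [Fintype nA] [DecidableEq nA]
    [Fintype nB] [DecidableEq nB] {M : Matrix (nA × nB) (nA × nB) ℂ} (hM : M.PosSemidef) :
    (redA M).PosSemidef := by
  have h : _root_.redA M = ∑ b, M.submatrix (fun a => (a, b)) (fun a => (a, b)) := by
    ext a a'
    simp [_root_.redA, Matrix.sum_apply]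
  rw [h]
  exact Matrix.posSemidef_sum _ fun b _ => hM.submatrix _

lemma Matrix.PosSemidef.redB {nA nB : Type*} [Fintype nA] [DecidableEq nA]
    [Fintype nB] [DecidableEq nB] {M : Matrix (nA × nB) (nA × nB) ℂ} (hM : M.PosSemidef) :
    (redB M).PosSemidef := by
  have h : _root_.redB M = ∑ a, M.submatrix (fun b => (a, b)) (fun b => (a, b)) := by
    ext b b'
    simp [_root_.redB, Matrix.sum_apply]
  rw [h]
  exact Matrix.posSemidef_sum _ fun a _ => hM.submatrix _

lemma Matrix.PosSemidef.dephA {nA nB : Type*} [Fintype nA] [DecidableEq nA]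
    [Fintype nB] [DecidableEq nB] {M : Matrix (nA × nB) (nA × nB) ℂ} (hM : M.PosSemidef) :
    (dephA M).PosSemidef := by
  let P (a : nA) : Matrix (nA × nB) (nA × nB) ℂ :=
    Matrix.diagonal fun p => if p.1 = a then 1 else 0
  have h : _root_.dephA M = ∑ a, P a * M * (P a)ᴴ := by
    ext p q
    simp [_root_.dephA, P, Matrix.sum_apply, Matrix.diagonal_conjTranspose, Pi.star_apply,
      apply_ite star, eq_comm]
  rw [h]
  exact Matrix.posSemidef_sum _ fun a _ => hM.mul_mul_conjTranspose_same _

lemma vN_le_card {n : Type*} [Fintype n] [DecidableEq n] {M : Matrix n n ℂ}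
    (hM : M.PosSemidef) : vN M ≤ Fintype.card n := by
  rw [hM.1.vN_eq_sum_negMulLog]
  calc _ ≤ ∑ _i : n, (1 : ℝ) := Finset.sum_le_sum fun i _ => by
        linarith [Real.negMulLog_le_one_sub_self (hM.eigenvalues_nonneg i),
          hM.eigenvalues_nonneg i]
    _ = _ := by simp

lemma vN_nonneg {n : Type*} [Fintype n] [DecidableEq n] {M : Matrix n n ℂ}
    (hM : M.PosSemidef) (htr : M.trace = 1) : 0 ≤ vN M := by
  rw [hM.1.vN_eq_sum_negMulLog]
  have hsum : ∑ i, hM.1.eigenvalues i = 1 := by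
    have h := hM.1.trace_eq_sum_eigenvalues
    rw [htr] at h
    simpa using (congrArg Complex.re h).symm
  refine Finset.sum_nonneg fun i _ => Real.negMulLog_nonneg (hM.eigenvalues_nonneg i) ?_
  rw [← hsum]
  exact Finset.single_le_sum (fun j _ => hM.eigenvalues_nonneg j) (Finset.mem_univ i)

/-- Integral representation of `x log (x / y) - x + y`; the weight `p` only has to vanish where
that expression is infinite. -/
lemma integral_weighted_relative_entropy {x y p : ℝ} (hx : 0 ≤ x) (hy : 0 ≤ y)
    (h : y = 0 → p * x = 0) :
    IntervalIntegrable (fun t => t * (p * ((x - y) ^ 2 / ((1 - t) * x + t * y))))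
      MeasureTheory.volume 0 1 ∧
    ∫ t in (0 : ℝ)..1, t * (p * ((x - y) ^ 2 / ((1 - t) * x + t * y))) =
      p * (x * Real.log x - x * Real.log y - x + y) := by
  rcases eq_or_ne p 0 with rfl | hp
  · simp
  rcases hx.eq_or_lt with rfl | hx
  · rcases hy.eq_or_lt with rfl | hy
    · simp
    have hae : ∀ t ∈ Set.uIoc (0 : ℝ) 1,
        p * y = t * (p * ((0 - y) ^ 2 / ((1 - t) * 0 + t * y))) := fun t ht => by
      rw [Set.uIoc_of_le zero_le_one] at ht
      have := ht.1.ne'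
      field_simp
      ring
    refine ⟨(intervalIntegrable_const (c := p * y)).congr hae, ?_⟩
    rw [← intervalIntegral.integral_congr_ae (Filter.Eventually.of_forall hae)]
    simp
  have hy : 0 < y := hy.lt_of_ne' fun h0 => by simp_all [hx.ne']
  have hpos : ∀ t ∈ Set.uIcc (0 : ℝ) 1, 0 < (1 - t) * x + t * y := fun t ht => by
    rw [Set.uIcc_of_le zero_le_one] at ht
    rcases ht.1.eq_or_lt with rfl | h0
    · simpa using hx
    · exact add_pos_of_nonneg_of_pos (mul_nonneg (by linarith [ht.2]) hx.le) (mul_pos h0 hy)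
  have hint : IntervalIntegrable (fun t => t * (p * ((x - y) ^ 2 / ((1 - t) * x + t * y))))
      MeasureTheory.volume 0 1 := by
    refine ContinuousOn.intervalIntegrable ?_
    refine continuousOn_id.mul (continuousOn_const.mul (continuousOn_const.div ?_ ?_))
    · fun_prop
    · exact fun t ht => (hpos t ht).ne'
  refine ⟨hint, ?_⟩
  rw [intervalIntegral.integral_eq_sub_of_hasDerivAt
    (f := fun t => p * ((y - x) * t - x * Real.log ((1 - t) * x + t * y))) (fun t ht => ?_) hint]
  · simp
    ring
  · have hne := (hpos t ht).ne'
    have key : ∀ k : ℝ, k ≠ 0 → (1 - t) * x + t * y = k →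
        p * ((y - x) * 1 - x * ((-1 * x + 1 * y) / k)) = t * (p * ((x - y) ^ 2 / k)) := by
      rintro k hk rfl
      rw [← mul_right_inj' hk]
      field_simp
      ring
    have h1 : HasDerivAt (fun t : ℝ => (1 - t) * x + t * y) (-1 * x + 1 * y) t :=
      (((hasDerivAt_id t).const_sub 1).mul_const x).add ((hasDerivAt_id t).mul_const y)
    have h2 := ((((hasDerivAt_id t).const_mul (y - x)).sub
      ((h1.log hne).const_mul x)).const_mul p)
    exact h2.congr_deriv (key _ hne rfl)

/-- The functional, real-linear in `M`, whose supremum over `Y` is the quadratic form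
`⟨M - Δ(M), ((1 - t) L_M + t R_{Δ(M)})⁻¹ (M - Δ(M))⟩`. -/
noncomputable def cohForm {n : Type*} [Fintype n] [DecidableEq n] (t : ℝ)
    (M Y : Matrix n n ℂ) : ℝ :=
  2 * ((M - deph M) * Yᴴ).trace.re - (1 - t) * (M * (Y * Yᴴ)).trace.re
    - t * (deph M * (Yᴴ * Y)).trace.re

lemma trace_redB_mul {nA nB : Type*} [Fintype nA] [DecidableEq nA]
    [Fintype nB] [DecidableEq nB] (M : Matrix (nA × nB) (nA × nB) ℂ) (X : Matrix nB nB ℂ) :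
    (redB M * X).trace = (M * ((1 : Matrix nA nA ℂ) ⊗ₖ X)).trace := by
  simp only [redB, Matrix.trace, Matrix.mul_apply, Matrix.diag_apply, Matrix.of_apply,
    Fintype.sum_prod_type, Matrix.kronecker_apply, Matrix.one_apply, Finset.sum_mul]
  rw [Finset.sum_congr rfl fun b _ => Finset.sum_comm, Finset.sum_comm]
  refine Finset.sum_congr rfl fun a _ => Finset.sum_congr rfl fun b _ => ?_
  rw [Finset.sum_comm]
  simp

lemma deph_redB {nA nB : Type*} [Fintype nA] [DecidableEq nA] [Fintype nB] [DecidableEq nB]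
    (M : Matrix (nA × nB) (nA × nB) ℂ) : deph (redB M) = redB (deph M) := by
  ext b b'
  by_cases h : b = b' <;> simp [deph, redB, Matrix.diagonal_apply, h]

lemma redB_sub {nA nB : Type*} [Fintype nA] [DecidableEq nA] [Fintype nB] [DecidableEq nB]
    (M N : Matrix (nA × nB) (nA × nB) ℂ) : redB (M - N) = redB M - redB N := by
  ext b b'
  simp [redB]

lemma cohForm_redB {nA nB : Type*} [Fintype nA] [DecidableEq nA] [Fintype nB] [DecidableEq nB]
    (t : ℝ) (M : Matrix (nA × nB) (nA × nB) ℂ) (Y : Matrix nB nB ℂ) :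
    cohForm t (redB M) Y = cohForm t M ((1 : Matrix nA nA ℂ) ⊗ₖ Y) := by
  have h1 : ((1 : Matrix nA nA ℂ) ⊗ₖ Y)ᴴ = (1 : Matrix nA nA ℂ) ⊗ₖ Yᴴ := by
    rw [Matrix.conjTranspose_kronecker, Matrix.conjTranspose_one]
  simp only [cohForm, h1, ← Matrix.mul_kronecker_mul, one_mul, deph_redB, ← redB_sub,
    trace_redB_mul]

lemma two_mul_re_sub_le {c k : ℝ} (hk : 0 ≤ k) (hc : k = 0 → c = 0) (u w : ℂ) :
    2 * c * (u * w).re - k * Complex.normSq w ≤ Complex.normSq u * (c ^ 2 / k) := by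
  rcases hk.eq_or_lt with rfl | hk
  · simp [hc rfl]
  have h : Complex.normSq u * (c ^ 2 / k) - (2 * c * (u * w).re - k * Complex.normSq w) =
      k * ((c / k * u.re - w.re) ^ 2 + (c / k * u.im + w.im) ^ 2) := by
    simp only [Complex.normSq_apply, Complex.mul_re]
    field_simp
    ring
  nlinarith [mul_nonneg hk.le (add_nonneg (sq_nonneg (c / k * u.re - w.re))
    (sq_nonneg (c / k * u.im + w.im)))]

lemma two_mul_re_sub_eq {c k : ℝ} (hc : k = 0 → c = 0) (u : ℂ) :
    2 * c * (u * ((c / k : ℝ) * star u)).re - k * Complex.normSq ((c / k : ℝ) * star u) =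
      Complex.normSq u * (c ^ 2 / k) := by
  rcases eq_or_ne k 0 with rfl | hk
  · simp [hc rfl]
  simp [Complex.normSq_apply]
  field_simp
  ring

lemma cohForm_unitary_mul {n : Type*} [Fintype n] [DecidableEq n] {U : Matrix n n ℂ}
    (hU : Uᴴ * U = 1) {d m : n → ℝ} {M : Matrix n n ℂ}
    (hM : M = U * Matrix.diagonal (fun i => (d i : ℂ)) * Uᴴ)
    (hm : deph M = Matrix.diagonal fun j => (m j : ℂ)) (t : ℝ) (W : Matrix n n ℂ) :
    cohForm t M (U * W) = ∑ i, ∑ j, (2 * (d i - m j) * (U j i * W i j).re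
      - ((1 - t) * d i + t * m j) * Complex.normSq (W i j)) := by
  set D := Matrix.diagonal fun i => (d i : ℂ) with hD
  set E := Matrix.diagonal fun i => (m i : ℂ) with hE
  have h1 : ((M - E) * (U * W)ᴴ).trace = ((D * Uᴴ - Uᴴ * E) * Wᴴ).trace := by
    rw [Matrix.conjTranspose_mul, Matrix.trace_mul_comm, Matrix.mul_assoc, Matrix.trace_mul_comm,
      Matrix.mul_sub, hM]
    simp only [← Matrix.mul_assoc, hU, Matrix.one_mul]
  have h2 : (M * (U * W * (U * W)ᴴ)).trace = (D * (W * Wᴴ)).trace := by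
    have : M * (U * W * (U * W)ᴴ) = U * (D * (W * Wᴴ) * Uᴴ) := by
      rw [hM, Matrix.conjTranspose_mul]
      simp only [Matrix.mul_assoc]
      rw [← Matrix.mul_assoc Uᴴ U, hU, Matrix.one_mul]
    rw [this, Matrix.trace_mul_comm, Matrix.mul_assoc, hU, Matrix.mul_one]
  have h3 : (U * W)ᴴ * (U * W) = Wᴴ * W := by
    rw [Matrix.conjTranspose_mul, Matrix.mul_assoc, ← Matrix.mul_assoc Uᴴ, hU, Matrix.one_mul]
  have e1 : ((D * Uᴴ - Uᴴ * E) * Wᴴ).trace.re =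
      ∑ i, ∑ j, (d i - m j) * (U j i * W i j).re := by
    simp only [Matrix.trace, Matrix.diag_apply, Matrix.mul_apply (N := Wᴴ), Matrix.sub_apply,
      hD, hE, Matrix.diagonal_mul, Matrix.mul_diagonal, Matrix.conjTranspose_apply,
      Complex.re_sum]
    refine Finset.sum_congr rfl fun i _ => Finset.sum_congr rfl fun j _ => ?_
    simp
    ring
  have e2 : (D * (W * Wᴴ)).trace.re = ∑ i, ∑ j, d i * Complex.normSq (W i j) := by
    simp only [Matrix.trace, Matrix.diag_apply, hD, Matrix.diagonal_mul, Matrix.mul_apply (N := Wᴴ),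
      Matrix.conjTranspose_apply, Finset.mul_sum, Complex.re_sum]
    refine Finset.sum_congr rfl fun i _ => Finset.sum_congr rfl fun j _ => ?_
    simp [Complex.normSq_apply]
  have e3 : (E * (Wᴴ * W)).trace.re = ∑ i, ∑ j, m j * Complex.normSq (W i j) := by
    rw [Finset.sum_comm]
    simp only [Matrix.trace, Matrix.diag_apply, hE, Matrix.diagonal_mul, Matrix.mul_apply (M := Wᴴ),
      Matrix.conjTranspose_apply, Finset.mul_sum, Complex.re_sum]
    refine Finset.sum_congr rfl fun i _ => Finset.sum_congr rfl fun j _ => ?_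
    simp [Complex.normSq_apply]
  rw [cohForm, hm, h1, h2, h3, e1, e2, e3]
  simp only [Finset.mul_sum, ← Finset.sum_sub_distrib]
  refine Finset.sum_congr rfl fun i _ => Finset.sum_congr rfl fun j _ => ?_
  ring

lemma coh_eq_integral {n : Type*} [Fintype n] [DecidableEq n] {M : Matrix n n ℂ}
    (hM : M.PosSemidef) : ∃ G : ℝ → ℝ,
      IntervalIntegrable (fun t => t * G t) MeasureTheory.volume 0 1 ∧
      coh M = ∫ t in (0 : ℝ)..1, t * G t ∧
      ∀ t ∈ Set.Ioo (0 : ℝ) 1, IsGreatest (Set.range (cohForm t M)) (G t) := by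
  set U : Matrix n n ℂ := (hM.1.eigenvectorUnitary : Matrix n n ℂ) with hUdef
  set d := hM.1.eigenvalues with hd
  have hU : Uᴴ * U = 1 := Matrix.mem_unitaryGroup_iff'.1 hM.1.eigenvectorUnitary.2
  have hU' : U * Uᴴ = 1 := Matrix.mem_unitaryGroup_iff.1 hM.1.eigenvectorUnitary.2
  have hspec : M = U * Matrix.diagonal (fun i => (d i : ℂ)) * Uᴴ := by
    conv_lhs => rw [hM.1.spectral_theorem, Unitary.conjStarAlgAut_apply]
    rfl
  have hd0 : ∀ i, 0 ≤ d i := hM.eigenvalues_nonneg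
  let m : n → ℝ := fun j => ∑ i, Complex.normSq (U j i) * d i
  have hMm : ∀ j, M j j = (m j : ℂ) := fun j => by
    conv_lhs => rw [hspec]
    rw [Matrix.mul_apply]
    simp only [Matrix.mul_diagonal, Matrix.conjTranspose_apply, m, Complex.ofReal_sum,
      Complex.ofReal_mul, Complex.normSq_eq_conj_mul_self]
    refine Finset.sum_congr rfl fun i _ => ?_
    simp only [RCLike.star_def]
    ring
  have hdeph : deph M = Matrix.diagonal fun j => (m j : ℂ) := by simp [deph, hMm]
  have hm0 : ∀ j, 0 ≤ m j := fun j =>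
    Finset.sum_nonneg fun i _ => mul_nonneg (Complex.normSq_nonneg _) (hd0 i)
  have hrow : ∀ i, ∑ j, Complex.normSq (U j i) = 1 := fun i => by
    have h := congrFun₂ hU i i
    simp only [Matrix.mul_apply, Matrix.conjTranspose_apply, RCLike.star_def,
      ← Complex.normSq_eq_conj_mul_self, Matrix.one_apply_eq] at h
    exact_mod_cast h
  have hcol : ∀ j, ∑ i, Complex.normSq (U j i) = 1 := fun j => by
    have h := congrFun₂ hU' j j
    simp only [Matrix.mul_apply, Matrix.conjTranspose_apply, RCLike.star_def,
      mul_comm (U j _), ← Complex.normSq_eq_conj_mul_self, Matrix.one_apply_eq] at h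
    exact_mod_cast h
  have hzero : ∀ i j, m j = 0 → Complex.normSq (U j i) * d i = 0 := fun i j h =>
    (Finset.sum_eq_zero_iff_of_nonneg
      fun i _ => mul_nonneg (Complex.normSq_nonneg _) (hd0 i)).1 h i (Finset.mem_univ i)
  have hI := fun i j => integral_weighted_relative_entropy (hd0 i) (hm0 j) (hzero i j)
  have hI' : ∀ i, IntervalIntegrable (fun t => ∑ j, t * (Complex.normSq (U j i) *
      ((d i - m j) ^ 2 / ((1 - t) * d i + t * m j)))) MeasureTheory.volume 0 1 := fun i => by
    simpa only [Finset.sum_fn] using IntervalIntegrable.sum Finset.univ fun j _ => (hI i j).1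
  refine ⟨fun t => ∑ i, ∑ j,
    Complex.normSq (U j i) * ((d i - m j) ^ 2 / ((1 - t) * d i + t * m j)), ?_, ?_, ?_⟩
  · simp only [Finset.mul_sum]
    simpa only [Finset.sum_fn] using IntervalIntegrable.sum Finset.univ fun i _ => hI' i
  · simp only [Finset.mul_sum]
    rw [intervalIntegral.integral_finsetSum fun i _ => hI' i]
    simp_rw [intervalIntegral.integral_finsetSum fun j _ => (hI _ j).1, (hI _ _).2]
    rw [coh, hdeph, vN_diagonal, hM.1.vN_eq_sum_negMulLog, ← hd]
    have hterm : ∀ i j, Complex.normSq (U j i) *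
        (d i * Real.log (d i) - d i * Real.log (m j) - d i + m j) =
        Complex.normSq (U j i) * (d i * Real.log (d i) - d i)
        - Complex.normSq (U j i) * d i * Real.log (m j)
        + Complex.normSq (U j i) * m j := fun i j => by ring
    simp only [hterm, Finset.sum_add_distrib, Finset.sum_sub_distrib]
    rw [Finset.sum_comm (f := fun i j => Complex.normSq (U j i) * d i * Real.log (m j)),
      Finset.sum_comm (f := fun i j => Complex.normSq (U j i) * m j)]
    simp only [← Finset.sum_mul, hrow, hcol, one_mul, Finset.sum_sub_distrib]
    have hsum : ∑ j, m j = ∑ i, d i := by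
      simp only [m]
      rw [Finset.sum_comm]
      simp only [← Finset.sum_mul, hrow, one_mul]
    rw [hsum]
    simp only [Real.negMulLog, neg_mul, Finset.sum_neg_distrib, m]
    ring
  · intro t ht
    have hk : ∀ i j, 0 ≤ (1 - t) * d i + t * m j := fun i j =>
      add_nonneg (mul_nonneg (by linarith [ht.2]) (hd0 i)) (mul_nonneg ht.1.le (hm0 j))
    have hc : ∀ i j, (1 - t) * d i + t * m j = 0 → d i - m j = 0 := fun i j h => by
      have h1 := mul_nonneg (sub_nonneg.2 ht.2.le) (hd0 i)
      have h2 := mul_nonneg ht.1.le (hm0 j)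
      have h3 : d i = 0 := by
        simpa [(sub_pos.2 ht.2).ne'] using (by linarith : (1 - t) * d i = 0)
      have h4 : m j = 0 := by simpa [ht.1.ne'] using (by linarith : t * m j = 0)
      rw [h3, h4, sub_zero]
    constructor
    · refine ⟨U * Matrix.of fun i j =>
        ((((d i - m j) / ((1 - t) * d i + t * m j) : ℝ) : ℂ) * star (U j i)), ?_⟩
      rw [cohForm_unitary_mul hU hspec hdeph]
      exact Finset.sum_congr rfl fun i _ => Finset.sum_congr rfl fun j _ =>
        two_mul_re_sub_eq (hc i j) _
    · rintro _ ⟨Y, rfl⟩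
      have hY : Y = U * (Uᴴ * Y) := by rw [← Matrix.mul_assoc, hU', Matrix.one_mul]
      rw [hY, cohForm_unitary_mul hU hspec hdeph]
      exact Finset.sum_le_sum fun i _ => Finset.sum_le_sum fun j _ =>
        two_mul_re_sub_le (hk i j) (hc i j) _ _

/-- The relative entropy of coherence does not increase under a partial trace. -/
lemma coh_redB_le {nA nB : Type*} [Fintype nA] [DecidableEq nA] [Fintype nB] [DecidableEq nB]
    {M : Matrix (nA × nB) (nA × nB) ℂ} (hM : M.PosSemidef) : coh (redB M) ≤ coh M := by
  obtain ⟨G, hG, hcoh, hGmax⟩ := coh_eq_integral hM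
  obtain ⟨G', hG', hcoh', hGmax'⟩ := coh_eq_integral hM.redB
  rw [hcoh, hcoh']
  refine intervalIntegral.integral_mono_on_of_le_Ioo zero_le_one hG' hG fun t ht => ?_
  refine mul_le_mul_of_nonneg_left ?_ ht.1.le
  obtain ⟨Y, hY⟩ := (hGmax' t ht).1
  rw [← hY, cohForm_redB]
  exact (hGmax t ht).2 ⟨_, rfl⟩

lemma redA_dephA {nA nB : Type*} [Fintype nA] [DecidableEq nA] [Fintype nB] [DecidableEq nB]
    (M : Matrix (nA × nB) (nA × nB) ℂ) : redA (dephA M) = deph (redA M) := by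
  ext a a'
  by_cases h : a = a' <;> simp [dephA, redA, deph, h]

lemma redB_dephA {nA nB : Type*} [Fintype nA] [DecidableEq nA] [Fintype nB] [DecidableEq nB]
    (M : Matrix (nA × nB) (nA × nB) ℂ) : redB (dephA M) = redB M := by
  ext b b'
  simp [dephA, redB]

lemma deph_dephA {nA nB : Type*} [Fintype nA] [DecidableEq nA] [Fintype nB] [DecidableEq nB]
    (M : Matrix (nA × nB) (nA × nB) ℂ) : deph (dephA M) = deph M := by
  simp [dephA, deph]

lemma trace_conjA {nA nB : Type*} [Fintype nA] [DecidableEq nA] [Fintype nB] [DecidableEq nB]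
    (U : Matrix.unitaryGroup nA ℂ) (M : Matrix (nA × nB) (nA × nB) ℂ) :
    (conjA (U : Matrix nA nA ℂ) M).trace = M.trace := by
  have hU : (U : Matrix nA nA ℂ)ᴴ * U = 1 := Matrix.mem_unitaryGroup_iff'.1 U.2
  rw [conjA, Matrix.trace_mul_comm, ← Matrix.mul_assoc, Matrix.conjTranspose_kronecker,
    ← Matrix.mul_kronecker_mul, hU, Matrix.conjTranspose_one, Matrix.one_mul,
    Matrix.one_kronecker_one, Matrix.one_mul]

lemma mi_le_card_add_card {nA nB : Type*} [Fintype nA] [DecidableEq nA]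
    [Fintype nB] [DecidableEq nB] {M : Matrix (nA × nB) (nA × nB) ℂ}
    (hM : M.PosSemidef) (htr : M.trace = 1) :
    mi M ≤ Fintype.card nA + Fintype.card nB := by
  rw [mi]
  linarith [vN_le_card hM.redA, vN_le_card hM.redB, vN_nonneg hM htr]

/-- Theorem 2: `Θ^{A|B}(ρ) + C(ρ^A) + C(ρ^B) ≤ C(ρ)`. -/
theorem zurek_discord_add_local_coherences_le_coherence
    {nA nB : Type*} [Fintype nA] [DecidableEq nA] [Nonempty nA]
    [Fintype nB] [DecidableEq nB] [Nonempty nB]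
    (ρ : Matrix (nA × nB) (nA × nB) ℂ) (hρ : ρ.PosSemidef) (htr : ρ.trace = 1) :
    (⨅ U : Matrix.unitaryGroup nA ℂ, (mi ρ - mi (dephA (conjA (U : Matrix nA nA ℂ) ρ))))
      + coh (redA ρ) + coh (redB ρ) ≤ coh ρ := by
  have hbdd : BddBelow (Set.range fun U : Matrix.unitaryGroup nA ℂ =>
      mi ρ - mi (dephA (conjA (U : Matrix nA nA ℂ) ρ))) := by
    refine ⟨mi ρ - (Fintype.card nA + Fintype.card nB), ?_⟩
    rintro _ ⟨U, rfl⟩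
    exact sub_le_sub_left (mi_le_card_add_card (hρ.mul_mul_conjTranspose_same _).dephA
      ((trace_dephA _).trans ((trace_conjA U ρ).trans htr))) _
  have hinf := ciInf_le hbdd 1
  have hone : conjA ((1 : Matrix.unitaryGroup nA ℂ) : Matrix nA nA ℂ) ρ = ρ := by
    simp [conjA]
  have hmono := coh_redB_le hρ.dephA
  simp only [hone, mi, redA_dephA, redB_dephA] at hinf
  simp only [coh, redB_dephA, deph_dephA] at hmono
  simp only [coh, mi, redA_dephA, redB_dephA]
  linarith
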